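/- Let C be a skeletally small triangulated category and let D be a dense triangulated subcategory of C. Then D is radical if and only if the quotient group G(C)/image(G(D) → G(C)) is torsion free. -/

import Mathlib

open CategoryTheory CategoryTheory.Limits CategoryTheory.Pretriangulated
open scoped TensorProduct

universe v u

set_option linter.unusedSectionVars false
set_option linter.unusedVariables false

namespace GrothendieckPaper

variable (C : Type u) [Category.{v} C] [Preadditive C] [Limits.HasZeroObject C]
  [HasShift C ℤ] [∀ n : ℤ, (shiftFunctor C n).Additive] [Pretriangulated C]

/-- The set of Euler relations `[V] - [U] - [W]` coming from distinguished triangles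
`U ⟶ V ⟶ W ⟶ U⟦1⟧`. -/
def eulerSet : Set (FreeAbelianGroup C) :=
  { x | ∃ T : Triangle C, (T ∈ distTriang C) ∧
      x = FreeAbelianGroup.of T.obj₂ - FreeAbelianGroup.of T.obj₁ - FreeAbelianGroup.of T.obj₃ }

def eulerSubgroup : AddSubgroup (FreeAbelianGroup C) := AddSubgroup.closure (eulerSet C)

/-- The Grothendieck group of a (skeletally small) triangulated category. -/
def G : Type u := FreeAbelianGroup C ⧸ eulerSubgroup C

instance : AddCommGroup (G C) := QuotientAddGroup.Quotient.addCommGroup _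

/-- The class `[U]` of an object `U` in the Grothendieck group. -/
def cls (U : C) : G C := QuotientAddGroup.mk (FreeAbelianGroup.of U)

/-- A (strictly full) triangulated subcategory of `C`, given by its set of objects:
closed under isomorphisms, under the shifts `[1]` and `[-1]`, and under extensions
(cones): if `X ⟶ Y ⟶ Z ⟶ X⟦1⟧` is distinguished and `X, Y` belong then so does `Z`. -/
structure IsTriangulatedSubcat (S : Set C) : Prop where
  mem_of_iso : ∀ {X Y : C}, (X ≅ Y) → Y ∈ S → X ∈ S
  shift_mem : ∀ {X : C}, X ∈ S → ((shiftFunctor C (1 : ℤ)).obj X) ∈ S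
  shift_neg_mem : ∀ {X : C}, X ∈ S → ((shiftFunctor C (-1 : ℤ)).obj X) ∈ S
  ext_mem : ∀ (T : Triangle C), (T ∈ distTriang C) → T.obj₁ ∈ S → T.obj₂ ∈ S → T.obj₃ ∈ S

/-- `npowAux U n` is the direct sum of `n + 1` copies of `U`. -/
noncomputable def npowAux (U : C) : ℕ → C
  | 0 => U
  | n + 1 => U ⊞ npowAux U n

/-- `npow U n` is the direct sum `U^n` of `n` copies of `U` (for `n ≥ 1`;
`npow U 0` is defined to be `U` as a junk value). -/
noncomputable def npow (U : C) (n : ℕ) : C := npowAux C U (n - 1)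

/-- A subcategory (set of objects) `S` is dense in `C` if every object of `C` is a
direct summand of an object of `S`. -/
def DenseSub (S : Set C) : Prop := ∀ U : C, ∃ V : C, (U ⊞ V) ∈ S

/-- A subcategory `S` is radical if `U^n ∈ S` for some `n ≥ 1` implies `U ∈ S`. -/
def RadicalSub (S : Set C) : Prop := ∀ (U : C) (n : ℕ), 1 ≤ n → npow C U n ∈ S → U ∈ S

/-- `√S = { U | U^n ∈ S for some n ≥ 1 }`. -/
def sqrtSet (S : Set C) : Set C := { U : C | ∃ n : ℕ, 1 ≤ n ∧ npow C U n ∈ S }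

lemma subset_sqrtSet (S : Set C) : S ⊆ sqrtSet C S := fun U hU => ⟨1, le_refl 1, hU⟩

/-- The Euler relations for the full subcategory on `S`, coming from distinguished
triangles of `C` all of whose vertices lie in `S`. -/
def eulerSetSub (S : Set C) : Set (FreeAbelianGroup S) :=
  { x | ∃ (T : Triangle C) (_ : T ∈ distTriang C) (h1 : T.obj₁ ∈ S) (h2 : T.obj₂ ∈ S)
      (h3 : T.obj₃ ∈ S),
      x = FreeAbelianGroup.of (⟨T.obj₂, h2⟩ : S) - FreeAbelianGroup.of ⟨T.obj₁, h1⟩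
        - FreeAbelianGroup.of ⟨T.obj₃, h3⟩ }

/-- The Grothendieck group of the triangulated subcategory on the set of objects `S`. -/
def GSub (S : Set C) : Type u := FreeAbelianGroup S ⧸ AddSubgroup.closure (eulerSetSub C S)

instance (S : Set C) : AddCommGroup (GSub C S) := QuotientAddGroup.Quotient.addCommGroup _

lemma delta_le (S : Set C) :
    AddSubgroup.closure (eulerSetSub C S) ≤
      (eulerSubgroup C).comap (FreeAbelianGroup.map (Subtype.val : S → C)) := by
  rw [AddSubgroup.closure_le]
  rintro x ⟨T, hT, h1, h2, h3, rfl⟩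
  simp only [SetLike.mem_coe, AddSubgroup.mem_comap, map_sub, FreeAbelianGroup.map_of_apply]
  exact AddSubgroup.subset_closure ⟨T, hT, rfl⟩

/-- The natural map `δ^S : G(S) → G(C)` induced by the inclusion of the subcategory. -/
def deltaHom (S : Set C) : GSub C S →+ G C :=
  QuotientAddGroup.map _ _ (FreeAbelianGroup.map (Subtype.val : S → C)) (delta_le C S)

lemma incl_le {S S' : Set C} (h : S ⊆ S') :
    AddSubgroup.closure (eulerSetSub C S) ≤
      (AddSubgroup.closure (eulerSetSub C S')).comap
        (FreeAbelianGroup.map (Set.inclusion h)) := by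
  rw [AddSubgroup.closure_le]
  rintro x ⟨T, hT, h1, h2, h3, rfl⟩
  simp only [SetLike.mem_coe, AddSubgroup.mem_comap, map_sub, FreeAbelianGroup.map_of_apply]
  exact AddSubgroup.subset_closure ⟨T, hT, h h1, h h2, h h3, rfl⟩

/-- The map `G(S) → G(S')` induced by an inclusion `S ⊆ S'` of subcategories. -/
def inclHom {S S' : Set C} (h : S ⊆ S') : GSub C S →+ GSub C S' :=
  QuotientAddGroup.map _ _ (FreeAbelianGroup.map (Set.inclusion h)) (incl_le C h)

/-- `δ^S ⊗ ℚ : G(S)_ℚ → G(C)_ℚ`. -/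
noncomputable def deltaQ (S : Set C) : ℚ ⊗[ℤ] GSub C S →ₗ[ℚ] ℚ ⊗[ℤ] G C :=
  LinearMap.baseChange ℚ (deltaHom C S).toIntLinearMap

/-- The rationalization of the map induced by an inclusion of subcategories. -/
noncomputable def inclQ {S S' : Set C} (h : S ⊆ S') :
    ℚ ⊗[ℤ] GSub C S →ₗ[ℚ] ℚ ⊗[ℤ] GSub C S' :=
  LinearMap.baseChange ℚ (inclHom C h).toIntLinearMap

/-- The collection `I(H)` of dense triangulated subcategories `S` of `C` with
`image(δ^S_ℚ) = H`. -/
def denseFamily (H : Submodule ℚ (ℚ ⊗[ℤ] G C)) : Set (Set C) :=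
  { S | IsTriangulatedSubcat C S ∧ DenseSub C S ∧ LinearMap.range (deltaQ C S) = H }


section

open scoped ZeroObject

variable {C}

lemma IsTriangulatedSubcat.ext_mem₂ {S : Set C} (hS : IsTriangulatedSubcat C S)
    (T : Triangle C) (hT : T ∈ distTriang C) (h₁ : T.obj₁ ∈ S) (h₃ : T.obj₃ ∈ S) :
    T.obj₂ ∈ S :=
  hS.ext_mem T.invRotate (inv_rot_of_distTriang _ hT) (hS.shift_neg_mem h₃) h₁

lemma IsTriangulatedSubcat.biprod_mem {S : Set C} (hS : IsTriangulatedSubcat C S)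
    {X Y : C} (hX : X ∈ S) (hY : Y ∈ S) : (X ⊞ Y) ∈ S :=
  hS.ext_mem₂ _ (binaryBiproductTriangle_distinguished X Y) hX hY

lemma IsTriangulatedSubcat.mem_of_biprod_mem {S : Set C} (hS : IsTriangulatedSubcat C S)
    {X Y : C} (hX : X ∈ S) (h : (X ⊞ Y) ∈ S) : Y ∈ S :=
  hS.ext_mem _ (binaryBiproductTriangle_distinguished X Y) hX h

lemma IsTriangulatedSubcat.zero_mem {S : Set C} (hS : IsTriangulatedSubcat C S)
    (hd : DenseSub C S) : (0 : C) ∈ S := by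
  obtain ⟨V, hV⟩ := hd 0
  exact hS.ext_mem _ (contractible_distinguished _) hV hV

/-- The middle-four interchange for biproducts. -/
noncomputable def biprodInterchange (U U' W W' : C) :
    (U ⊞ U') ⊞ (W ⊞ W') ≅ (U ⊞ W) ⊞ (U' ⊞ W') where
  hom := biprod.lift (biprod.map biprod.fst biprod.fst) (biprod.map biprod.snd biprod.snd)
  inv := biprod.lift (biprod.map biprod.fst biprod.fst) (biprod.map biprod.snd biprod.snd)
  hom_inv_id := by ext <;> simp
  inv_hom_id := by ext <;> simp

/-- A product indexed by `Bool` is a binary biproduct. -/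
noncomputable def piBoolIsoBiprod (f : Bool → C) : ∏ᶜ f ≅ f true ⊞ f false where
  hom := biprod.lift (Pi.π f true) (Pi.π f false)
  inv := Pi.lift (fun b => match b with
    | true => biprod.fst
    | false => biprod.snd)
  hom_inv_id := by
    apply Pi.hom_ext
    rintro (_ | _) <;> simp
  inv_hom_id := by
    apply biprod.hom_ext <;> simp

lemma exists_distTriang_biprod (T T' : Triangle C) (hT : T ∈ distTriang C)
    (hT' : T' ∈ distTriang C) :
    ∃ T'' ∈ distTriang C, Nonempty (T''.obj₁ ≅ T.obj₁ ⊞ T'.obj₁) ∧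
      Nonempty (T''.obj₂ ≅ T.obj₂ ⊞ T'.obj₂) ∧ Nonempty (T''.obj₃ ≅ T.obj₃ ⊞ T'.obj₃) := by
  let F : Bool → Triangle C := fun b => if b then T else T'
  refine ⟨productTriangle F, productTriangle_distinguished F ?_,
    ⟨piBoolIsoBiprod _⟩, ⟨piBoolIsoBiprod _⟩, ⟨piBoolIsoBiprod _⟩⟩
  rintro (_ | _)
  · exact hT'
  · exact hT

/-- Two objects are stably equivalent if they have a common complement into `S`. -/
def StablyEquiv (S : Set C) (U V : C) : Prop := ∃ W : C, (U ⊞ W) ∈ S ∧ (V ⊞ W) ∈ S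

lemma StablyEquiv.trans {S : Set C} (hS : IsTriangulatedSubcat C S) {U V X : C}
    (h₁ : StablyEquiv S U V) (h₂ : StablyEquiv S V X) : StablyEquiv S U X := by
  obtain ⟨W, hU, hV⟩ := h₁
  obtain ⟨W', hV', hX⟩ := h₂
  refine ⟨W ⊞ (V ⊞ W'), hS.mem_of_iso (biprod.associator _ _ _).symm (hS.biprod_mem hU hV'), ?_⟩
  refine hS.mem_of_iso ?_ (hS.biprod_mem hV hX)
  exact biprod.mapIso (Iso.refl X) ((biprod.associator _ _ _).symm ≪≫
      biprod.mapIso (biprod.braiding _ _) (Iso.refl _)) ≪≫ biprod.braiding _ _ ≪≫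
    biprod.associator _ _ _ ≪≫ biprod.mapIso (Iso.refl _) (biprod.braiding _ _)

lemma StablyEquiv.of_iso {S : Set C} (hS : IsTriangulatedSubcat C S) (hd : DenseSub C S)
    {U V : C} (e : U ≅ V) : StablyEquiv S U V := by
  obtain ⟨W, hW⟩ := hd V
  exact ⟨W, hS.mem_of_iso (biprod.mapIso e (Iso.refl W)) hW, hW⟩

lemma StablyEquiv.biprod {S : Set C} (hS : IsTriangulatedSubcat C S) {U V U' V' : C}
    (h : StablyEquiv S U V) (h' : StablyEquiv S U' V') : StablyEquiv S (U ⊞ U') (V ⊞ V') := by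
  obtain ⟨W, hU, hV⟩ := h
  obtain ⟨W', hU', hV'⟩ := h'
  exact ⟨W ⊞ W', hS.mem_of_iso (biprodInterchange _ _ _ _) (hS.biprod_mem hU hU'),
    hS.mem_of_iso (biprodInterchange _ _ _ _) (hS.biprod_mem hV hV')⟩

lemma stablyEquiv_zero_iff {S : Set C} (hS : IsTriangulatedSubcat C S) (hd : DenseSub C S)
    (U : C) : StablyEquiv S U 0 ↔ U ∈ S := by
  constructor
  · rintro ⟨W, hU, hW⟩
    exact hS.mem_of_biprod_mem (hS.mem_of_biprod_mem (hS.zero_mem hd) hW)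
      (hS.mem_of_iso (biprod.braiding _ _) hU)
  · intro hU
    exact ⟨0, hS.biprod_mem hU (hS.zero_mem hd),
      hS.biprod_mem (hS.zero_mem hd) (hS.zero_mem hd)⟩

lemma StablyEquiv.of_distTriang {S : Set C} (hS : IsTriangulatedSubcat C S)
    (hd : DenseSub C S) (T : Triangle C) (hT : T ∈ distTriang C) :
    StablyEquiv S T.obj₂ (T.obj₁ ⊞ T.obj₃) := by
  obtain ⟨U', hU⟩ := hd T.obj₁
  obtain ⟨W', hW⟩ := hd T.obj₃
  obtain ⟨T'', hT'', ⟨e₁⟩, ⟨e₂⟩, ⟨e₃⟩⟩ :=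
    exists_distTriang_biprod T _ hT (binaryBiproductTriangle_distinguished U' W')
  exact ⟨U' ⊞ W',
    hS.mem_of_iso e₂.symm (hS.ext_mem₂ T'' hT'' (hS.mem_of_iso e₁ hU) (hS.mem_of_iso e₃ hW)),
    hS.mem_of_iso (biprodInterchange _ _ _ _) (hS.biprod_mem hU hW)⟩

/-- Stable equivalence as a setoid. -/
def stableSetoid {S : Set C} (hS : IsTriangulatedSubcat C S) (hd : DenseSub C S) : Setoid C where
  r := StablyEquiv S
  iseqv :=
    { refl := fun U => .of_iso hS hd (Iso.refl U)
      symm := fun ⟨W, hU, hV⟩ => ⟨W, hV, hU⟩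
      trans := fun h₁ h₂ => h₁.trans hS h₂ }

/-- The group of objects of `C` up to stable equivalence modulo a dense triangulated
subcategory, with addition induced by the biproduct. -/
def StableGroup {S : Set C} (hS : IsTriangulatedSubcat C S) (hd : DenseSub C S) : Type u :=
  Quotient (stableSetoid hS hd)

namespace StableGroup

variable {S : Set C} (hS : IsTriangulatedSubcat C S) (hd : DenseSub C S)

/-- The stable class of an object. -/
def mk (U : C) : StableGroup hS hd := Quotient.mk (stableSetoid hS hd) U

lemma mk_eq_mk_iff {U V : C} : mk hS hd U = mk hS hd V ↔ StablyEquiv S U V :=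
  Quotient.eq (r := stableSetoid hS hd)

lemma mk_surjective : Function.Surjective (mk hS hd) := Quotient.mk_surjective

noncomputable instance : Add (StableGroup hS hd) :=
  ⟨Quotient.map₂ (fun U V => U ⊞ V) fun _ _ h _ _ h' => StablyEquiv.biprod hS h h'⟩

noncomputable instance : Zero (StableGroup hS hd) := ⟨mk hS hd 0⟩

noncomputable instance : Neg (StableGroup hS hd) :=
  ⟨fun x => mk hS hd (hd (mk_surjective hS hd x).choose).choose⟩

lemma mk_biprod (U V : C) : mk hS hd (U ⊞ V) = mk hS hd U + mk hS hd V := rfl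

lemma mk_eq_zero_iff (U : C) : mk hS hd U = 0 ↔ U ∈ S :=
  (mk_eq_mk_iff hS hd).trans (stablyEquiv_zero_iff hS hd U)

lemma add_comm' (x y : StableGroup hS hd) : x + y = y + x := by
  obtain ⟨U, rfl⟩ := mk_surjective hS hd x
  obtain ⟨V, rfl⟩ := mk_surjective hS hd y
  exact (mk_eq_mk_iff hS hd).2 (.of_iso hS hd (biprod.braiding U V))

lemma zero_add' (x : StableGroup hS hd) : 0 + x = x := by
  obtain ⟨U, rfl⟩ := mk_surjective hS hd x
  exact (mk_eq_mk_iff hS hd).2 (.of_iso hS hd (isoZeroBiprod (isZero_zero C)).symm)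

noncomputable instance : AddCommGroup (StableGroup hS hd) where
  add_assoc x y z := by
    obtain ⟨U, rfl⟩ := mk_surjective hS hd x
    obtain ⟨V, rfl⟩ := mk_surjective hS hd y
    obtain ⟨W, rfl⟩ := mk_surjective hS hd z
    exact (mk_eq_mk_iff hS hd).2 (.of_iso hS hd (biprod.associator U V W))
  zero_add := zero_add' hS hd
  add_zero x := by rw [add_comm', zero_add']
  add_comm := add_comm' hS hd
  nsmul := nsmulRec
  zsmul := zsmulRec
  neg_add_cancel x := by
    rw [add_comm']
    nth_rewrite 1 [← (mk_surjective hS hd x).choose_spec]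
    exact (mk_eq_zero_iff hS hd _).2 (hd (mk_surjective hS hd x).choose).choose_spec

/-- The canonical map from the Grothendieck group, sending `[U]` to the stable class of `U`. -/
noncomputable def ofG : G C →+ StableGroup hS hd :=
  QuotientAddGroup.lift (eulerSubgroup C) (FreeAbelianGroup.lift (mk hS hd)) <| by
    rw [eulerSubgroup, AddSubgroup.closure_le]
    rintro _ ⟨T, hT, rfl⟩
    have h : mk hS hd T.obj₂ = mk hS hd T.obj₁ + mk hS hd T.obj₃ :=
      (mk_eq_mk_iff hS hd).2 (.of_distTriang hS hd T hT)
    simp [h]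

lemma ofG_cls (U : C) : ofG hS hd (cls C U) = mk hS hd U :=
  FreeAbelianGroup.lift_apply_of (mk hS hd) U

end StableGroup

lemma cls_distTriang (T : Triangle C) (hT : T ∈ distTriang C) :
    cls C T.obj₂ = cls C T.obj₁ + cls C T.obj₃ := by
  have h : (QuotientAddGroup.mk (FreeAbelianGroup.of T.obj₂ - FreeAbelianGroup.of T.obj₁
      - FreeAbelianGroup.of T.obj₃) : G C) = 0 :=
    (QuotientAddGroup.eq_zero_iff _).2 (AddSubgroup.subset_closure ⟨T, hT, rfl⟩)
  have h' : cls C T.obj₂ - cls C T.obj₁ - cls C T.obj₃ = 0 := h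
  rwa [sub_sub, sub_eq_zero] at h'

lemma cls_biprod (U V : C) : cls C (U ⊞ V) = cls C U + cls C V :=
  cls_distTriang _ (binaryBiproductTriangle_distinguished U V)

lemma cls_zero : cls C (0 : C) = 0 := by
  simpa using! cls_distTriang _ (contractible_distinguished (0 : C))

lemma cls_shift (U : C) : cls C (U⟦(1 : ℤ)⟧) = -cls C U := by
  have h : cls C (0 : C) = cls C U + cls C (U⟦(1 : ℤ)⟧) :=
    cls_distTriang _ (contractible_distinguished₂ U)
  rw [cls_zero] at h
  exact eq_neg_of_add_eq_zero_right h.symm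

lemma cls_surjective : Function.Surjective (cls C) := by
  intro x
  obtain ⟨y, rfl⟩ := QuotientAddGroup.mk_surjective x
  induction y using FreeAbelianGroup.induction_on with
  | zero => exact ⟨0, cls_zero⟩
  | of U => exact ⟨U, rfl⟩
  | neg U _ => exact ⟨U⟦(1 : ℤ)⟧, cls_shift U⟩
  | add a b ha hb =>
    obtain ⟨U, hU⟩ := ha
    obtain ⟨V, hV⟩ := hb
    exact ⟨U ⊞ V, (cls_biprod U V).trans (congrArg₂ (· + ·) hU hV)⟩

lemma cls_npow (U : C) {n : ℕ} (hn : 0 < n) : cls C (npow C U n) = n • cls C U := by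
  obtain ⟨m, rfl⟩ := Nat.exists_eq_add_one_of_ne_zero hn.ne'
  change cls C (npowAux C U m) = _
  clear hn
  induction m with
  | zero => simp [npowAux]
  | succ m ih => rw [npowAux, cls_biprod, ih, succ_nsmul' _ (m + 1)]

/-- The object part of Thomason's classification: an object belongs to a dense triangulated
subcategory if and only if its class comes from that subcategory. -/
lemma cls_mem_range_iff {S : Set C} (hS : IsTriangulatedSubcat C S) (hd : DenseSub C S)
    (U : C) : cls C U ∈ (deltaHom C S).range ↔ U ∈ S := by
  constructor
  · rintro ⟨x, hx⟩
    rw [← StableGroup.mk_eq_zero_iff hS hd, ← StableGroup.ofG_cls, ← hx]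
    obtain ⟨y, rfl⟩ := QuotientAddGroup.mk_surjective x
    have h : ((StableGroup.ofG hS hd).comp (deltaHom C S)).comp
        (QuotientAddGroup.mk' (AddSubgroup.closure (eulerSetSub C S))) = 0 := by
      ext V
      exact (StableGroup.ofG_cls hS hd V.1).trans ((StableGroup.mk_eq_zero_iff hS hd _).2 V.2)
    exact DFunLike.congr_fun h y
  · intro hU
    exact ⟨QuotientAddGroup.mk (FreeAbelianGroup.of ⟨U, hU⟩), rfl⟩

end

/-- a dense triangulated subcategory `D` is radical if and only if the
quotient group `G(C)/image(G(D) → G(C))` is torsion free. -/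
theorem radical_iff_quotient_torsionFree (S : Set C) (hS : IsTriangulatedSubcat C S)
    (hdense : DenseSub C S) :
    RadicalSub C S ↔
      ∀ (x : G C ⧸ (deltaHom C S).range) (n : ℕ), 0 < n → n • x = 0 → x = 0 := by
  constructor
  · intro hrad x n hn hx
    obtain ⟨y, rfl⟩ := QuotientAddGroup.mk_surjective x
    obtain ⟨U, rfl⟩ := cls_surjective y
    rw [QuotientAddGroup.eq_zero_iff, cls_mem_range_iff hS hdense]
    refine hrad U n hn ?_
    rwa [← cls_mem_range_iff hS hdense, cls_npow U hn, ← QuotientAddGroup.eq_zero_iff]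
  · intro htf U n hn hU
    rw [← cls_mem_range_iff hS hdense, ← QuotientAddGroup.eq_zero_iff]
    refine htf _ n hn ?_
    rwa [← cls_mem_range_iff hS hdense, cls_npow U hn, ← QuotientAddGroup.eq_zero_iff] at hU


end GrothendieckPaper
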